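/- Let n ≥ 2 and let Ω ⊆ ℝ^n be a bounded open convex set with 0 ∈ Ω, and write r = r_max(Ω). Then for every δ > 0 there exists ε₀ > 0 such that for all 0 < ε < ε₀: W(Ω) − W(Ω_ε) ≥ 2r·(V(Ω) − V(Ω_ε)) + r²·(P(Ω) − P(Ω_ε)) − δ·[(V(Ω) − V(Ω_ε)) + (P(Ω) − P(Ω_ε))]. -/

import Mathlib

open MeasureTheory Metric Set Real Bornology

noncomputable section

/-- Volume (Lebesgue measure) of a set in `ℝⁿ`. -/
def vol (n : ℕ) (Ω : Set (EuclideanSpace ℝ (Fin n))) : ℝ :=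
  (volume Ω).toReal

/-- Surface area: the `(n-1)`-dimensional Hausdorff measure of the topological boundary. -/
def perim (n : ℕ) (Ω : Set (EuclideanSpace ℝ (Fin n))) : ℝ :=
  (μH[(n : ℝ) - 1] (frontier Ω)).toReal

/-- Boundary momentum `W(Ω) = ∫_{∂Ω} |x|² dH^{n-1}(x)`. -/
def bmom (n : ℕ) (Ω : Set (EuclideanSpace ℝ (Fin n))) : ℝ :=
  ∫ x in frontier Ω, ‖x‖ ^ 2 ∂μH[(n : ℝ) - 1]

/-- The scale invariant functional `λ(Ω) = W(Ω) / (P(Ω) V(Ω)^{2/n})`. -/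
def lamFun (n : ℕ) (Ω : Set (EuclideanSpace ℝ (Fin n))) : ℝ :=
  bmom n Ω / (perim n Ω * vol n Ω ^ ((2 : ℝ) / n))

/-- `ω_n`: the Lebesgue measure of the unit ball of `ℝⁿ`. -/
def unitBallVol (n : ℕ) : ℝ :=
  (volume (ball (0 : EuclideanSpace ℝ (Fin n)) 1)).toReal

/-- `r_max(Ω) = max {|x| : x ∈ closure Ω}`. -/
def rmax (n : ℕ) (Ω : Set (EuclideanSpace ℝ (Fin n))) : ℝ :=
  sSup ((fun x => ‖x‖) '' closure Ω)

/-- The Excess `E(Ω) = r_max(Ω) - W(Ω) / (n V(Ω))`. -/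
def excess (n : ℕ) (Ω : Set (EuclideanSpace ℝ (Fin n))) : ℝ :=
  rmax n Ω - bmom n Ω / ((n : ℝ) * vol n Ω)


/-- A `1`-Lipschitz map does not increase Hausdorff measure, as an inequality of measures on
the image. -/
theorem hausdorffMeasure_restrict_image_le_map {X Y : Type*} [EMetricSpace X] [EMetricSpace Y]
    [MeasurableSpace X] [BorelSpace X] [MeasurableSpace Y] [BorelSpace Y] {f : X → Y}
    (hf : LipschitzWith 1 f) {d : ℝ} (hd : 0 ≤ d) (s : Set X) :
    (μH[d] : Measure Y).restrict (f '' s) ≤ ((μH[d] : Measure X).restrict s).map f := by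
  refine Measure.le_iff.2 fun A hA => ?_
  have hfm : Measurable f := hf.continuous.measurable
  rw [Measure.restrict_apply hA, Measure.map_apply hfm hA, Measure.restrict_apply (hfm hA),
    inter_comm A, ← image_inter_preimage, inter_comm s]
  simpa using hf.hausdorffMeasure_image_le hd (f ⁻¹' A ∩ s)

/-- Radial projection onto the boundary of a bounded convex neighbourhood of `0` is Lipschitz on
annuli. -/
theorem exists_lipschitzOnWith_inv_gauge_smul {E : Type*} [NormedAddCommGroup E]
    [NormedSpace ℝ E] {Ω : Set E} (hbd : IsBounded Ω) (hconv : Convex ℝ Ω)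
    (h0 : Ω ∈ nhds (0 : E)) (M : ℝ) :
    ∃ K, LipschitzOnWith K (fun w => (gauge Ω w)⁻¹ • w) {w | 1 ≤ ‖w‖ ∧ ‖w‖ ≤ M} := by
  obtain ⟨K, hK⟩ := hconv.lipschitz_gauge h0
  obtain ⟨R, hR, hΩR⟩ := hbd.subset_closedBall_lt 0 (0 : E)
  refine ⟨(R + M * K * R ^ 2).toNNReal, LipschitzOnWith.of_dist_le_mul ?_⟩
  rintro x ⟨hx1, hxM⟩ y ⟨hy1, hyM⟩
  have hg : ∀ w : E, 1 ≤ ‖w‖ → 1 / R ≤ gauge Ω w := fun w hw =>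
    (div_le_div_of_nonneg_right hw hR.le).trans
      (le_gauge_of_subset_closedBall (absorbent_nhds_zero h0) hR.le hΩR)
  have hgx := hg x hx1
  have hgy := hg y hy1
  have hRi : 0 < 1 / R := by positivity
  have hx0 : 0 < gauge Ω x := hRi.trans_le hgx
  have hy0 : 0 < gauge Ω y := hRi.trans_le hgy
  have hxi : (gauge Ω x)⁻¹ ≤ R := by
    rw [inv_le_comm₀ hx0 hR]; simpa using hgx
  have hyi : (gauge Ω y)⁻¹ ≤ R := by
    rw [inv_le_comm₀ hy0 hR]; simpa using hgy
  have hM : 0 ≤ M := (norm_nonneg x).trans hxM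
  have hdist := hK.dist_le_mul x y
  rw [Real.dist_eq, dist_eq_norm] at hdist
  rw [Real.coe_toNNReal _ (by positivity), dist_eq_norm, dist_eq_norm]
  have key : (gauge Ω x)⁻¹ • x - (gauge Ω y)⁻¹ • y
      = (gauge Ω x)⁻¹ • (x - y)
        + ((gauge Ω x)⁻¹ * (gauge Ω y)⁻¹ * (gauge Ω y - gauge Ω x)) • y := by
    have : (gauge Ω x)⁻¹ * (gauge Ω y)⁻¹ * (gauge Ω y - gauge Ω x)
        = (gauge Ω x)⁻¹ - (gauge Ω y)⁻¹ := by field_simp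
    rw [this]; module
  have hx0i := (inv_pos.2 hx0).le
  have hy0i := (inv_pos.2 hy0).le
  rw [key]
  calc _ ≤ (gauge Ω x)⁻¹ * ‖x - y‖
        + (gauge Ω x)⁻¹ * (gauge Ω y)⁻¹ * |gauge Ω x - gauge Ω y| * ‖y‖ := by
        refine (norm_add_le _ _).trans (le_of_eq ?_)
        rw [norm_smul, norm_smul, Real.norm_eq_abs, Real.norm_eq_abs, abs_mul, abs_mul,
          abs_of_nonneg hx0i, abs_of_nonneg hy0i, abs_sub_comm]
    _ ≤ R * ‖x - y‖ + R * R * (K * ‖x - y‖) * M := by gcongr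
    _ = _ := by ring

/-- The boundary of a bounded open convex set in `ℝ^{m+1}` has finite `m`-dimensional Hausdorff
measure. -/
theorem hausdorffMeasure_frontier_lt_top {m : ℕ} {Ω : Set (EuclideanSpace ℝ (Fin (m + 1)))}
    (hbd : IsBounded Ω) (hop : IsOpen Ω) (hconv : Convex ℝ Ω)
    (h0 : (0 : EuclideanSpace ℝ (Fin (m + 1))) ∈ Ω) :
    μH[(m : ℝ)] (frontier Ω) < ⊤ := by
  have hnhds := hop.mem_nhds h0
  let W : Fin (m + 1) → ℝ → (Fin m → ℝ) → EuclideanSpace ℝ (Fin (m + 1)) :=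
    fun i c v => WithLp.toLp 2 (Fin.insertNth (α := fun _ => ℝ) i c v)
  let ψ : EuclideanSpace ℝ (Fin (m + 1)) → EuclideanSpace ℝ (Fin (m + 1)) :=
    fun w => (gauge Ω w)⁻¹ • w
  have hW : ∀ i c, ∃ K, LipschitzWith K (W i c) := by
    intro i c
    have h2 : LipschitzWith 1 (fun v : Fin m → ℝ => Fin.insertNth (α := fun _ => ℝ) i c v) := by
      refine LipschitzWith.of_dist_le_mul fun v w => ?_
      simp [Fin.dist_insertNth_insertNth]
    exact ⟨_, (PiLp.lipschitzWith_toLp 2 (fun _ : Fin (m + 1) => ℝ)).comp h2⟩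
  have hfin : ∀ i, ∀ c : ℝ, |c| = 1 →
      μH[(m : ℝ)] ((fun v => ψ (W i c v)) '' closedBall 0 1) < ⊤ := by
    intro i c hc
    obtain ⟨K₁, hK₁⟩ := hW i c
    obtain ⟨M, hM⟩ := (((isCompact_closedBall (0 : Fin m → ℝ) 1).image
      hK₁.continuous).isBounded).exists_norm_le
    obtain ⟨K₂, hK₂⟩ := exists_lipschitzOnWith_inv_gauge_smul hbd hconv hnhds M
    have hL : LipschitzOnWith (K₂ * K₁) (fun v => ψ (W i c v)) (closedBall 0 1) := by
      refine hK₂.comp hK₁.lipschitzOnWith fun v hv => ⟨?_, hM _ (mem_image_of_mem _ hv)⟩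
      have := PiLp.norm_apply_le (W i c v) i
      simpa [W, hc] using this
    refine (hL.hausdorffMeasure_image_le (Nat.cast_nonneg m)).trans_lt ?_
    have hvol : (μH[(m : ℝ)] : Measure (Fin m → ℝ)) = volume := by
      simpa using hausdorffMeasure_pi_real (ι := Fin m)
    rw [hvol]
    exact ENNReal.mul_lt_top
      (ENNReal.rpow_lt_top_of_nonneg (Nat.cast_nonneg m) ENNReal.coe_ne_top)
      (isCompact_closedBall _ _).measure_lt_top
  have hcov : frontier Ω ⊆ ⋃ i : Fin (m + 1),
      ((fun v => ψ (W i 1 v)) '' closedBall 0 1) ∪ ((fun v => ψ (W i (-1) v)) '' closedBall 0 1) := by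
    intro y hy
    have hgy : gauge Ω y = 1 := (gauge_eq_one_iff_mem_frontier hconv hnhds).2 hy
    have hy0 : y ≠ 0 := by rintro rfl; simp at hgy
    obtain ⟨i, hi⟩ := Finite.exists_max fun i => |y i|
    have hc : 0 < |y i| := by
      refine lt_of_le_of_ne (abs_nonneg _) fun h => hy0 ?_
      ext j
      have := hi j
      rw [← h] at this
      simpa using this
    let v : Fin m → ℝ := i.removeNth (fun j => |y i|⁻¹ * y j)
    have hv : v ∈ closedBall (0 : Fin m → ℝ) 1 := by
      rw [mem_closedBall_zero_iff, pi_norm_le_iff_of_nonneg zero_le_one]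
      intro j
      simp only [v, Fin.removeNth, Real.norm_eq_abs, abs_mul, abs_inv, abs_abs]
      rw [inv_mul_le_one₀ hc]
      exact hi _
    have hWy : ∀ c, |y i|⁻¹ * y i = c → ψ (W i c v) = y := by
      rintro c rfl
      have h1 : W i (|y i|⁻¹ * y i) v = |y i|⁻¹ • y := by
        ext j
        simp only [W, v]
        have := Fin.insertNth_self_removeNth (α := fun _ => ℝ) i (fun j => |y i|⁻¹ * y j)
        exact congrFun this j
      simp only [ψ]
      rw [h1, gauge_smul_of_nonneg (inv_nonneg.2 hc.le), hgy, smul_smul]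
      simp [hc.ne']
    refine mem_iUnion.2 ⟨i, ?_⟩
    rcases le_total 0 (y i) with h | h
    · left
      refine ⟨v, hv, hWy 1 ?_⟩
      rw [abs_of_nonneg h] at hc ⊢
      exact inv_mul_cancel₀ hc.ne'
    · right
      refine ⟨v, hv, hWy (-1) ?_⟩
      rw [abs_of_nonpos h] at hc ⊢
      rw [inv_neg, neg_mul, inv_mul_cancel₀ (neg_pos.1 hc).ne]
  refine (measure_mono hcov).trans_lt ?_
  refine (measure_iUnion_fintype_le _ _).trans_lt (ENNReal.sum_lt_top.2 fun i _ => ?_)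
  exact (measure_union_le _ _).trans_lt
    (ENNReal.add_lt_top.2 ⟨hfin i 1 (by simp), hfin i (-1) (by simp)⟩)

open RealInnerProductSpace in
/-- Isometric coordinates splitting off a unit direction `u`: the height `⟪x, u⟫` and the remaining
coordinates, the latter measured with the sup norm. -/
theorem exists_heightCoordinates {m : ℕ} (u : EuclideanSpace ℝ (Fin (m + 1))) (hu : ‖u‖ = 1) :
    ∃ e : EuclideanSpace ℝ (Fin (m + 1)) ≃ᵐ ℝ × (Fin m → ℝ), MeasurePreserving e ∧
      (∀ x, (e x).1 = ⟪x, u⟫) ∧ LipschitzWith 1 (fun x => (e x).2) ∧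
      ∀ x (t : ℝ), e (x + t • u) = ((e x).1 + t, (e x).2) := by
  obtain ⟨b, hb⟩ := Orthonormal.exists_orthonormalBasis_extension_of_card_eq (𝕜 := ℝ)
    (E := EuclideanSpace ℝ (Fin (m + 1))) (ι := Fin (m + 1)) (by simp) (v := fun _ => u)
    (s := {0}) (by
      constructor
      · intro i; simpa using hu
      · intro i j hij; exact absurd (Subsingleton.elim i j) hij)
  have hb0 : b 0 = u := hb 0 rfl
  let e := (b.repr.toHomeomorph.toMeasurableEquiv.trans
    (MeasurableEquiv.toLp 2 (Fin (m + 1) → ℝ)).symm).trans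
      (MeasurableEquiv.piFinSuccAbove (fun _ => ℝ) 0)
  have he1 : ∀ x, (e x).1 = b.repr x 0 := fun x => rfl
  have he2 : ∀ x i, (e x).2 i = b.repr x (Fin.succ i) := fun x i => rfl
  refine ⟨e, ?_, ?_, ?_, ?_⟩
  · exact (volume_preserving_piFinSuccAbove (fun _ => ℝ) 0).comp
      ((EuclideanSpace.volume_preserving_symm_measurableEquiv_toLp (Fin (m + 1))).comp
        b.measurePreserving_repr)
  · intro x
    rw [he1, b.repr_apply_apply, hb0, real_inner_comm]
  · refine LipschitzWith.of_dist_le_mul fun x y => ?_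
    rw [NNReal.coe_one, one_mul, dist_pi_le_iff dist_nonneg]
    intro i
    rw [he2, he2, Real.dist_eq, ← b.repr.dist_map, dist_eq_norm]
    exact PiLp.norm_apply_le (b.repr x - b.repr y) (Fin.succ i)
  · intro x t
    have hr : b.repr u = EuclideanSpace.single 0 1 := by rw [← hb0, b.repr_self]
    refine Prod.ext ?_ (funext fun i => ?_)
    · simp [he1, hr]
    · simp [he2, hr]

section Cap

open RealInnerProductSpace

variable {E : Type*} [NormedAddCommGroup E] [InnerProductSpace ℝ E]

/-- Points of the closure lying high enough in the direction `u` can be pushed down into the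
open convex set. -/
theorem sub_smul_mem_of_mem_closure {Ω : Set E} (hop : IsOpen Ω) (hconv : Convex ℝ Ω)
    {u : E} (hu : ‖u‖ = 1) {r h ρ : ℝ} (hr : ∀ x ∈ closure Ω, ‖x‖ ≤ r) (hh : 0 < h)
    (hρ : 0 < ρ) (hball : ball 0 ρ ⊆ Ω) (hsmall : r ^ 2 - h ^ 2 < ρ ^ 2) {x : E}
    (hx : x ∈ closure Ω) (hxh : h ≤ ⟪x, u⟫) {τ : ℝ} (hτ : 0 < τ) (hτx : τ ≤ ⟪x, u⟫) :
    x - τ • u ∈ Ω := by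
  have hpos : 0 < ⟪x, u⟫ := hh.trans_le hxh
  have hz : x - ⟪x, u⟫ • u ∈ Ω := by
    apply hball
    rw [mem_ball_zero_iff]
    refine lt_of_pow_lt_pow_left₀ 2 hρ.le ?_
    rw [norm_sub_sq_real, inner_smul_right, norm_smul, hu, Real.norm_eq_abs, mul_one, sq_abs]
    have h1 := pow_le_pow_left₀ (norm_nonneg x) (hr x hx) 2
    have h2 := pow_le_pow_left₀ hh.le hxh 2
    nlinarith
  have := hconv.combo_closure_interior_mem_interior hx (hop.interior_eq.symm ▸ hz)
    (a := 1 - τ / ⟪x, u⟫) (b := τ / ⟪x, u⟫) (sub_nonneg.2 ((div_le_one hpos).2 hτx))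
    (by positivity) (by ring)
  rw [hop.interior_eq] at this
  convert this using 1
  have h3 : τ = τ / ⟪x, u⟫ * ⟪x, u⟫ := by field_simp
  rw [smul_sub, smul_smul, ← h3]
  module

/-- The boundary of the part of `Ω` below height `h` consists of the part of the boundary of `Ω`
below height `h` and the section of the closure at height `h`. -/
theorem frontier_inter_halfSpace {Ω : Set E} (hop : IsOpen Ω) (hconv : Convex ℝ Ω)
    (h0 : (0 : E) ∈ Ω) {u : E} {h : ℝ} (hh : 0 < h) :
    frontier (Ω ∩ {x | ⟪x, u⟫ < h})
      = frontier Ω ∩ {x | ⟪x, u⟫ < h} ∪ closure Ω ∩ {x | ⟪x, u⟫ = h} := by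
  have hcont : Continuous fun x : E => ⟪x, u⟫ := by fun_prop
  have hT : IsOpen {x : E | ⟪x, u⟫ < h} := isOpen_lt hcont continuous_const
  have hlow := frontier_inter_open_inter (s := Ω) hT
  ext x
  constructor
  · intro hx
    by_cases hxT : ⟪x, u⟫ < h
    · exact Or.inl (hlow.subset ⟨hx, hxT⟩)
    · refine Or.inr ⟨closure_mono inter_subset_left hx.1, le_antisymm ?_ (not_lt.1 hxT)⟩
      have := closure_mono inter_subset_right hx.1
      exact closure_lt_subset_le hcont continuous_const this
  · rintro (hx | ⟨hxc, hxh⟩)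
    · exact (hlow.symm.subset hx).1
    · refine ⟨?_, fun hxi => ?_⟩
      · have hlim : Filter.Tendsto (fun t : ℝ => (1 - t) • x) (nhdsWithin 0 (Ioo 0 1))
            (nhds x) := by
          have : Continuous fun t : ℝ => (1 - t) • x := by fun_prop
          simpa using (this.tendsto 0).mono_left nhdsWithin_le_nhds
        have : (nhdsWithin (0 : ℝ) (Ioo 0 1)).NeBot := by
          rw [← mem_closure_iff_nhdsWithin_neBot, closure_Ioo zero_ne_one]
          simp
        refine mem_closure_of_tendsto hlim ?_
        filter_upwards [self_mem_nhdsWithin] with t ht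
        refine ⟨?_, ?_⟩
        · have := hconv.combo_closure_interior_mem_interior hxc
            (hop.interior_eq.symm ▸ h0) (a := 1 - t) (b := t) (by linarith [ht.2]) ht.1 (by ring)
          rw [hop.interior_eq] at this
          simpa using this
        · rw [mem_ofPred_eq] at hxh ⊢
          rw [real_inner_smul_left, hxh]
          nlinarith [ht.1]
      · have := interior_subset hxi
        exact this.2.ne hxh

/-- From a point of the closure of a bounded open set one reaches the boundary by moving in the
direction `u`. -/
theorem exists_add_smul_mem_frontier [ProperSpace E] {Ω : Set E} (hbd : IsBounded Ω)
    (hop : IsOpen Ω) {u : E} (hu : ‖u‖ = 1) {y : E} (hy : y ∈ closure Ω) :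
    ∃ t : ℝ, 0 ≤ t ∧ y + t • u ∈ frontier Ω := by
  have hcont : Continuous fun t : ℝ => y + t • u := by fun_prop
  have hK : IsCompact {t : ℝ | 0 ≤ t ∧ y + t • u ∈ closure Ω} := by
    obtain ⟨R, hR⟩ := hbd.closure.exists_norm_le
    refine Metric.isCompact_of_isClosed_isBounded ?_ ?_
    · exact isClosed_Ici.inter (isClosed_closure.preimage hcont)
    · refine (isBounded_Icc 0 (R + ‖y‖)).subset fun t ht => ⟨ht.1, ?_⟩
      have h1 := hR _ ht.2
      have h2 : ‖t • u‖ = t := by rw [norm_smul, hu, mul_one, Real.norm_of_nonneg ht.1]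
      have h3 := norm_sub_le (y + t • u) y
      rw [add_sub_cancel_left, h2] at h3
      linarith
  obtain ⟨t, ht, htmax⟩ := hK.exists_isMaxOn ⟨0, le_rfl, by simpa using hy⟩ continuousOn_id
  refine ⟨t, ht.1, ht.2, fun hnormInt => ?_⟩
  have hev : ∀ᶠ s in nhds t, y + s • u ∈ Ω :=
    hcont.continuousAt.eventually (hop.mem_nhds (interior_subset hnormInt))
  obtain ⟨s, hs, hts⟩ := ((hev.filter_mono nhdsWithin_le_nhds).and
    (self_mem_nhdsWithin (s := Ioi t))).exists
  have := htmax ⟨ht.1.trans (le_of_lt hts), subset_closure hs⟩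
  exact absurd hts (not_lt.2 this)

end Cap

open RealInnerProductSpace in
/-- Cutting a thin cap off a convex set changes volume, surface area and boundary momentum in a
controlled way. -/
theorem bmom_sub_bmom_inter_halfSpace {m : ℕ} {Ω : Set (EuclideanSpace ℝ (Fin (m + 1)))}
    (hbd : IsBounded Ω) (hop : IsOpen Ω) (hconv : Convex ℝ Ω)
    {u : EuclideanSpace ℝ (Fin (m + 1))} (hu : ‖u‖ = 1) {r h ρ : ℝ}
    (hr : ∀ x ∈ closure Ω, ‖x‖ ≤ r) (hh : 0 < h) (hρ : 0 < ρ) (hball : ball 0 ρ ⊆ Ω)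
    (hsmall : r ^ 2 - h ^ 2 < ρ ^ 2) :
    0 ≤ vol (m + 1) Ω - vol (m + 1) (Ω ∩ {x | ⟪x, u⟫ < h}) ∧
    0 ≤ perim (m + 1) Ω - perim (m + 1) (Ω ∩ {x | ⟪x, u⟫ < h}) ∧
    h ^ 2 * (perim (m + 1) Ω - perim (m + 1) (Ω ∩ {x | ⟪x, u⟫ < h})) +
      2 * h * (vol (m + 1) Ω - vol (m + 1) (Ω ∩ {x | ⟪x, u⟫ < h})) ≤
      bmom (m + 1) Ω - bmom (m + 1) (Ω ∩ {x | ⟪x, u⟫ < h}) := by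
  have h0 : (0 : EuclideanSpace ℝ (Fin (m + 1))) ∈ Ω := hball (mem_ball_self hρ)
  have huu : ⟪u, u⟫ = 1 := by rw [real_inner_self_eq_norm_sq, hu, one_pow]
  have hdim : ((m + 1 : ℕ) : ℝ) - 1 = m := by push_cast; ring
  have hcont : Continuous fun x : EuclideanSpace ℝ (Fin (m + 1)) => ⟪x, u⟫ := by fun_prop
  obtain ⟨e, hemp, he1, he2, headd⟩ := exists_heightCoordinates u hu
  have hdown : ∀ {x}, x ∈ closure Ω → h ≤ ⟪x, u⟫ → ∀ {τ : ℝ}, 0 < τ → τ ≤ ⟪x, u⟫ →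
      x - τ • u ∈ Ω := fun hx hxh _ hτ hτx =>
    sub_smul_mem_of_mem_closure hop hconv hu hr hh hρ hball hsmall hx hxh hτ hτx
  unfold vol perim bmom
  rw [hdim, frontier_inter_halfSpace hop hconv h0 hh]
  set μ : Measure (EuclideanSpace ℝ (Fin (m + 1))) := μH[(m : ℝ)]
  set T : Set (EuclideanSpace ℝ (Fin (m + 1))) := {x | ⟪x, u⟫ < h} with hT
  set F : Set (EuclideanSpace ℝ (Fin (m + 1))) := closure Ω ∩ {x | ⟪x, u⟫ = h}
  set L := frontier Ω ∩ T
  set S := frontier Ω \ T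
  set C := Ω \ T with hC
  have hTo : IsOpen T := isOpen_lt hcont continuous_const
  have hFclosed : IsClosed F := isClosed_closure.inter (isClosed_eq hcont continuous_const)
  have hSclosed : IsClosed S := isClosed_frontier.sdiff hTo
  have hLmeas : MeasurableSet L := isClosed_frontier.measurableSet.inter hTo.measurableSet
  have hCmeas : MeasurableSet C := hop.measurableSet.diff hTo.measurableSet
  let q : EuclideanSpace ℝ (Fin (m + 1)) → EuclideanSpace ℝ (Fin (m + 1)) :=
    fun x => x + (h - ⟪x, u⟫) • u
  have hqcont : Continuous q := by fun_prop
  have hqlip : LipschitzWith 1 q := by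
    refine LipschitzWith.of_dist_le_mul fun x y => ?_
    rw [NNReal.coe_one, one_mul, dist_eq_norm, dist_eq_norm]
    refine le_of_sq_le_sq ?_ (norm_nonneg _)
    have : q x - q y = (x - y) - ⟪x - y, u⟫ • u := by
      simp only [q, inner_sub_left]; module
    rw [this, norm_sub_sq_real, inner_smul_right, norm_smul, hu, Real.norm_eq_abs, mul_one, sq_abs]
    nlinarith [sq_nonneg ⟪x - y, u⟫]
  have hqadd : ∀ y, ⟪y, u⟫ = h → ∀ t : ℝ, q (y + t • u) = y := by
    intro y hy t
    simp only [q, inner_add_left, real_inner_smul_left, huu, hy]; module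
  have hqF : ∀ x ∈ closure Ω, h ≤ ⟪x, u⟫ → q x ∈ F := by
    intro x hx hxh
    refine ⟨?_, ?_⟩
    · rcases hxh.eq_or_lt with heq | hlt
      · simpa [q, ← heq] using hx
      · have := hdown hx hxh (τ := ⟪x, u⟫ - h) (sub_pos.2 hlt) (by linarith)
        refine subset_closure ?_
        convert this using 1
        simp only [q]; module
    · simp [q, inner_add_left, real_inner_smul_left, hu]
  have hqS : q '' S = F := by
    apply Subset.antisymm
    · rintro _ ⟨x, hx, rfl⟩
      exact hqF x hx.1.1 (not_lt.1 hx.2)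
    · intro y hy
      obtain ⟨t, ht, htf⟩ := exists_add_smul_mem_frontier hbd hop hu hy.1
      refine ⟨y + t • u, ⟨htf, ?_⟩, hqadd y hy.2 t⟩
      have h2 : ⟪y, u⟫ = h := hy.2
      simp [hT, inner_add_left, real_inner_smul_left, hu, h2, ht]
  have hFS : μ.restrict F ≤ (μ.restrict S).map q :=
    hqS ▸ hausdorffMeasure_restrict_image_le_map hqlip (Nat.cast_nonneg m) S
  have hfr : μ (frontier Ω) < ⊤ := hausdorffMeasure_frontier_lt_top hbd hop hconv h0
  have hSfin : μ S < ⊤ := (measure_mono sdiff_subset).trans_lt hfr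
  have hLfin : μ L < ⊤ := (measure_mono inter_subset_left).trans_lt hfr
  have hFle : μ F ≤ μ S := by
    have := hFS univ
    rwa [Measure.map_apply hqcont.measurable MeasurableSet.univ, preimage_univ,
      Measure.restrict_apply_univ, Measure.restrict_apply_univ] at this
  have hFfin : μ F < ⊤ := hFle.trans_lt hSfin
  have hLF : Disjoint L F := disjoint_left.2 fun x hx hx' => (hx.2 : ⟪x, u⟫ < h).ne hx'.2
  have hLS : Disjoint L S := disjoint_left.2 fun x hx hx' => hx'.2 hx.2
  have hsplit : frontier Ω = L ∪ S := (inter_union_sdiff _ _).symm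
  have hnormInt : ∀ A : Set (EuclideanSpace ℝ (Fin (m + 1))), MeasurableSet A → A ⊆ closure Ω →
      μ A < ⊤ → IntegrableOn (fun x => ‖x‖ ^ 2) A μ := by
    intro A hA hAΩ hAfin
    refine IntegrableOn.of_bound hAfin (by fun_prop) (r ^ 2) ?_
    refine ae_restrict_of_forall_mem hA fun x hx => ?_
    rw [Real.norm_of_nonneg (by positivity)]
    exact pow_le_pow_left₀ (norm_nonneg _) (hr x (hAΩ hx)) 2
  have hnormL := hnormInt L hLmeas (fun x hx => hx.1.1) hLfin
  have hintS := hnormInt S hSclosed.measurableSet (fun x hx => hx.1.1) hSfin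
  have hintF := hnormInt F hFclosed.measurableSet (fun x hx => hx.1) hFfin
  -- the differences of the functionals, in terms of the cap only
  have hP : (μ (frontier Ω)).toReal - (μ (L ∪ F)).toReal = μ.real S - μ.real F := by
    rw [hsplit, measure_union hLS hSclosed.measurableSet, measure_union hLF hFclosed.measurableSet,
      ENNReal.toReal_add hLfin.ne hSfin.ne, ENNReal.toReal_add hLfin.ne hFfin.ne]
    simp only [Measure.real]; ring
  have hW : ∫ x in frontier Ω, ‖x‖ ^ 2 ∂μ - ∫ x in L ∪ F, ‖x‖ ^ 2 ∂μ
      = ∫ x in S, ‖x‖ ^ 2 ∂μ - ∫ x in F, ‖x‖ ^ 2 ∂μ := by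
    rw [hsplit, setIntegral_union hLS hSclosed.measurableSet hnormL hintS,
      setIntegral_union hLF hFclosed.measurableSet hnormL hintF]
    ring
  have hV : (volume Ω).toReal - (volume (Ω ∩ T)).toReal = (volume C).toReal := by
    have hΩfin : volume Ω < ⊤ := hbd.measure_lt_top
    rw [← measure_inter_add_sdiff Ω hTo.measurableSet, ENNReal.toReal_add
      ((measure_mono inter_subset_left).trans_lt hΩfin).ne
      ((measure_mono sdiff_subset).trans_lt hΩfin).ne]
    ring
  have hPnonneg : 0 ≤ μ.real S - μ.real F :=
    sub_nonneg.2 (ENNReal.toReal_mono hSfin.ne hFle)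
  rw [hP, hW, hV]
  refine ⟨ENNReal.toReal_nonneg, hPnonneg, ?_⟩
  -- vertical thickness of the cap
  let ℓ : (Fin m → ℝ) → ENNReal := fun y => volume ((fun s => (s, y)) ⁻¹' (e.symm ⁻¹' C))
  have hCe : MeasurableSet (e.symm ⁻¹' C) := e.symm.measurable hCmeas
  have hℓmeas : Measurable ℓ := measurable_measure_prodMk_right hCe
  let p : EuclideanSpace ℝ (Fin (m + 1)) → (Fin m → ℝ) := fun x => (e x).2
  have hpmeas : Measurable p := measurable_snd.comp e.measurable
  have hℓS : ∀ x ∈ S, ℓ (p x) = ENNReal.ofReal (⟪x, u⟫ - h) := by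
    intro x hx
    have hxh : h ≤ ⟪x, u⟫ := not_lt.1 hx.2
    have hsymm : ∀ s, e.symm (s, p x) = x + (s - ⟪x, u⟫) • u := by
      intro s
      rw [MeasurableEquiv.symm_apply_eq, headd, he1]
      simp [p]
    have : (fun s => (s, p x)) ⁻¹' (e.symm ⁻¹' C) = Ico h ⟪x, u⟫ := by
      ext s
      simp only [mem_preimage, hsymm, hC, mem_sdiff, hT, mem_ofPred_eq, inner_add_left,
        real_inner_smul_left, huu, mul_one, add_sub_cancel, not_lt, mem_Ico]
      constructor
      · rintro ⟨hsΩ, hs⟩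
        refine ⟨hs, ?_⟩
        by_contra! hsx
        refine hx.1.2 (hop.interior_eq.symm ▸ ?_)
        rcases hsx.eq_or_lt with heq | hlt
        · simpa [← heq] using hsΩ
        · have hin : ⟪x + (s - ⟪x, u⟫) • u, u⟫ = s := by
            rw [inner_add_left, real_inner_smul_left, huu]; ring
          have := hdown (subset_closure hsΩ) (by rw [hin]; exact hs) (τ := s - ⟪x, u⟫)
            (sub_pos.2 hlt) (by rw [hin]; linarith)
          simpa using this
      · rintro ⟨hs, hsx⟩
        refine ⟨?_, hs⟩
        have := hdown hx.1.1 hxh (τ := ⟪x, u⟫ - s) (sub_pos.2 hsx) (by linarith)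
        convert this using 1
        module
    simp only [ℓ, this, Real.volume_Ico]
  have hpq : ∀ x, p (q x) = p x := fun x => by simp only [p, q, headd]
  let G : EuclideanSpace ℝ (Fin (m + 1)) → ℝ := fun x => (ℓ (p x)).toReal
  have hGmeas : Measurable G := (hℓmeas.comp hpmeas).ennreal_toReal
  have hGS : ∀ x ∈ S, G (q x) = ⟪x, u⟫ - h := by
    intro x hx
    simp only [G, hpq, hℓS x hx]
    exact ENNReal.toReal_ofReal (sub_nonneg.2 (not_lt.1 hx.2))
  have hℓF : ∀ y ∈ F, ℓ (p y) ≤ ENNReal.ofReal (r - h) := by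
    intro y hy
    obtain ⟨x, hx, rfl⟩ := hqS.symm ▸ hy
    rw [hpq, hℓS x hx]
    refine ENNReal.ofReal_le_ofReal (sub_le_sub_right ?_ _)
    calc ⟪x, u⟫ ≤ ‖x‖ * ‖u‖ := real_inner_le_norm _ _
      _ ≤ r := by rw [hu, mul_one]; exact hr x hx.1.1
  -- the volume of the cap
  have hvolC : volume C ≤ ∫⁻ x in F, ℓ (p x) ∂μ := by
    have hpF : ((volume : Measure (Fin m → ℝ))).restrict (p '' F) ≤ (μ.restrict F).map p := by
      have hvol : (μH[(m : ℝ)] : Measure (Fin m → ℝ)) = volume := by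
        simpa using hausdorffMeasure_pi_real (ι := Fin m)
      exact hvol ▸ hausdorffMeasure_restrict_image_le_map he2 (Nat.cast_nonneg m) F
    have hzero : ∀ y ∉ p '' F, ℓ y = 0 := by
      intro y hy
      have : (fun s => (s, y)) ⁻¹' (e.symm ⁻¹' C) = ∅ := by
        refine eq_empty_of_forall_notMem fun s hs => hy ⟨q (e.symm (s, y)), ?_, ?_⟩
        · exact hqF _ (subset_closure hs.1) (not_lt.1 hs.2)
        · rw [hpq]; simp [p]
      simp only [ℓ, this, measure_empty]
    have hpFmeas : MeasurableSet (p '' F) :=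
      ((Metric.isCompact_of_isClosed_isBounded hFclosed
        (hbd.closure.subset inter_subset_left)).image he2.continuous).measurableSet
    calc volume C = volume (e.symm ⁻¹' C) :=
          ((hemp.symm e).measure_preimage hCmeas.nullMeasurableSet).symm
      _ = ∫⁻ y, ℓ y := Measure.prod_apply_symm hCe
      _ = ∫⁻ y in p '' F, ℓ y := by
          rw [← lintegral_indicator hpFmeas]
          congr 1
          ext y
          by_cases hy : y ∈ p '' F
          · rw [indicator_of_mem hy]
          · rw [indicator_of_notMem hy, hzero y hy]
      _ ≤ ∫⁻ y, ℓ y ∂((μ.restrict F).map p) := lintegral_mono' hpF le_rfl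
      _ = ∫⁻ x in F, ℓ (p x) ∂μ := lintegral_map hℓmeas hpmeas
  have hFtop : IsFiniteMeasure (μ.restrict F) := ⟨by simpa using hFfin⟩
  have hStop : IsFiniteMeasure (μ.restrict S) := ⟨by simpa using hSfin⟩
  have hℓfin : ∫⁻ x in F, ℓ (p x) ∂μ < ⊤ := by
    refine (setLIntegral_mono' hFclosed.measurableSet hℓF).trans_lt ?_
    rw [setLIntegral_const]
    exact ENNReal.mul_lt_top ENNReal.ofReal_lt_top hFfin
  have hGint : Integrable G (μ.restrict F) :=
    integrable_toReal_of_lintegral_ne_top (hℓmeas.comp hpmeas).aemeasurable hℓfin.ne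
  have hVG : (volume C).toReal ≤ ∫ x in F, G x ∂μ := by
    have hG : ∫ x in F, G x ∂μ = (∫⁻ x in F, ℓ (p x) ∂μ).toReal :=
      integral_toReal (hℓmeas.comp hpmeas).aemeasurable
        (ae_lt_top (hℓmeas.comp hpmeas) hℓfin.ne)
    rw [hG]
    exact ENNReal.toReal_mono hℓfin.ne hvolC
  -- the squared norm on the cap as a function of the projection
  let f : EuclideanSpace ℝ (Fin (m + 1)) → ℝ := fun y => ‖y‖ ^ 2 - h ^ 2 + (2 * h * G y + G y ^ 2)
  have hfmeas : Measurable f := by fun_prop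
  have hfS : ∀ x ∈ S, f (q x) = ‖x‖ ^ 2 - h ^ 2 := by
    intro x hx
    simp only [f, hGS x hx, q]
    rw [norm_add_sq_real, inner_smul_right, norm_smul, hu, Real.norm_eq_abs, mul_one, sq_abs]
    ring
  have hfS' : (fun x => f (q x)) =ᵐ[μ.restrict S] fun x => ‖x‖ ^ 2 - h ^ 2 :=
    ae_restrict_of_forall_mem hSclosed.measurableSet hfS
  have hfint : Integrable f ((μ.restrict S).map q) := by
    rw [integrable_map_measure hfmeas.aestronglyMeasurable hqcont.aemeasurable]
    exact (Integrable.sub hintS (integrable_const _)).congr hfS'.symm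
  have hfnonneg : 0 ≤ᵐ[(μ.restrict S).map q] f := by
    rw [Filter.EventuallyLE, ae_map_iff hqcont.aemeasurable
      (measurableSet_le measurable_zero hfmeas)]
    refine ae_restrict_of_forall_mem hSclosed.measurableSet fun x hx => ?_
    rw [hfS x hx]
    have h1 : h ≤ ⟪x, u⟫ := not_lt.1 hx.2
    have h2 : ⟪x, u⟫ ≤ ‖x‖ := by simpa [hu] using real_inner_le_norm x u
    exact sub_nonneg.2 (pow_le_pow_left₀ hh.le (h1.trans h2) 2)
  have hmain : ∫ x in F, f x ∂μ ≤ ∫ x in S, ‖x‖ ^ 2 ∂μ - h ^ 2 * μ.real S := by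
    calc ∫ x in F, f x ∂μ ≤ ∫ x, f x ∂((μ.restrict S).map q) :=
          integral_mono_measure hFS hfnonneg hfint
      _ = ∫ x in S, f (q x) ∂μ :=
          integral_map hqcont.aemeasurable hfmeas.aestronglyMeasurable
      _ = ∫ x in S, (‖x‖ ^ 2 - h ^ 2) ∂μ := integral_congr_ae hfS'
      _ = _ := by
          rw [integral_sub hintS (integrable_const _), setIntegral_const, smul_eq_mul, mul_comm]
  have hintF' : Integrable (fun x => ‖x‖ ^ 2 - h ^ 2) (μ.restrict F) :=
    Integrable.sub hintF (integrable_const _)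
  have hlow : ∫ x in F, ‖x‖ ^ 2 ∂μ - h ^ 2 * μ.real F + 2 * h * ∫ x in F, G x ∂μ
      ≤ ∫ x in F, f x ∂μ := by
    calc _ = ∫ x in F, (‖x‖ ^ 2 - h ^ 2 + 2 * h * G x) ∂μ := by
          rw [integral_add hintF' (hGint.const_mul _),
            integral_sub hintF (integrable_const _), setIntegral_const, smul_eq_mul,
            mul_comm (μ.real F), integral_const_mul]
      _ ≤ _ := by
          refine integral_mono (hintF'.add (hGint.const_mul _)) (hfint.mono_measure hFS) fun x => ?_
          simp only [f]
          nlinarith [sq_nonneg (G x)]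
  nlinarith [mul_le_mul_of_nonneg_left hVG hh.le]

open RealInnerProductSpace in
/-- with `r = r_max(Ω)`, for every `δ > 0` and all small enough `ε`,
`W(Ω) - W(Ω_ε) ≥ 2r (V(Ω) - V(Ω_ε)) + r² (P(Ω) - P(Ω_ε)) - δ[(V(Ω) - V(Ω_ε)) + (P(Ω) - P(Ω_ε))]`,
where `Ω_ε` is the cut of `Ω` by the halfspace at distance `ε` from a farthest boundary point. -/
theorem bmom_change_lower_bound (n : ℕ) (hn : 2 ≤ n)
    (Ω : Set (EuclideanSpace ℝ (Fin n)))
    (hbd : IsBounded Ω) (hop : IsOpen Ω) (hconv : Convex ℝ Ω)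
    (h0 : (0 : EuclideanSpace ℝ (Fin n)) ∈ Ω)
    (xm : EuclideanSpace ℝ (Fin n)) (hxm : xm ∈ frontier Ω) (hxmax : ‖xm‖ = rmax n Ω)
    (δ : ℝ) (hδ : 0 < δ) :
    ∃ ε₀ : ℝ, 0 < ε₀ ∧ ∀ ε : ℝ, 0 < ε → ε < ε₀ →
      bmom n Ω - bmom n (Ω ∩ {x | ⟪x, ‖xm‖⁻¹ • xm⟫ < rmax n Ω - ε}) ≥
        2 * rmax n Ω * (vol n Ω - vol n (Ω ∩ {x | ⟪x, ‖xm‖⁻¹ • xm⟫ < rmax n Ω - ε})) +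
        rmax n Ω ^ 2 * (perim n Ω - perim n (Ω ∩ {x | ⟪x, ‖xm‖⁻¹ • xm⟫ < rmax n Ω - ε})) -
        δ * ((vol n Ω - vol n (Ω ∩ {x | ⟪x, ‖xm‖⁻¹ • xm⟫ < rmax n Ω - ε})) +
             (perim n Ω - perim n (Ω ∩ {x | ⟪x, ‖xm‖⁻¹ • xm⟫ < rmax n Ω - ε}))) := by
  obtain ⟨m, rfl⟩ : ∃ m, n = m + 1 := ⟨n - 1, by omega⟩
  obtain ⟨ρ, hρ, hball⟩ := Metric.isOpen_iff.1 hop 0 h0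
  have hr : ∀ x ∈ closure Ω, ‖x‖ ≤ rmax (m + 1) Ω := by
    obtain ⟨R, hR⟩ := hbd.closure.exists_norm_le
    refine fun x hx => le_csSup ⟨R, ?_⟩ (mem_image_of_mem _ hx)
    rintro _ ⟨y, hy, rfl⟩
    exact hR y hy
  have hxm0 : xm ≠ 0 := by
    rintro rfl
    exact hxm.2 (hop.interior_eq.symm ▸ h0)
  have hu : ‖‖xm‖⁻¹ • xm‖ = 1 := by
    rw [norm_smul, norm_inv, norm_norm, inv_mul_cancel₀ (norm_ne_zero_iff.2 hxm0)]
  set r := rmax (m + 1) Ω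
  have hrpos : 0 < r := hxmax ▸ norm_pos_iff.2 hxm0
  refine ⟨min r (min (δ / 2) (min (δ / (2 * r)) (ρ ^ 2 / (2 * r)))), by positivity,
    fun ε hε hε₀ => ?_⟩
  simp only [lt_min_iff] at hε₀
  obtain ⟨hεr, hεδ, hεδr, hερ⟩ := hε₀
  rw [lt_div_iff₀ (by positivity)] at hεδr hερ
  obtain ⟨hV, hP, hW⟩ := bmom_sub_bmom_inter_halfSpace hbd hop hconv hu hr
    (h := r - ε) (by linarith) hρ hball (by nlinarith)
  nlinarith [mul_nonneg (sub_nonneg.2 hεδ.le) hV, mul_nonneg (sub_nonneg.2 hεδr.le) hP,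
    mul_nonneg (sq_nonneg ε) hP]
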